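/- Resonant product bound: for $\alpha, \beta \in \mathbb{R}$ with $\alpha + \beta > 0$, there is a constant $C$ such that for all $f \in C^\alpha(\mathbb{T}^d)$ and $g \in C^\beta(\mathbb{T}^d)$, the resonant term satisfies $\|f \circ g\|_{C^{\alpha+\beta}} \leq C \|f\|_{C^\alpha} \|g\|_{C^\beta}$. -/

import Mathlib

/-! A concrete Littlewood–Paley / Hölder–Zygmund framework on the torus `𝕋^d`,
realized on the Fourier side: a distribution is represented by its Fourier
coefficients `c : (Fin d → ℤ) → ℂ`. -/

/-- A smooth cutoff `χ` with `χ = 1` on `[0,1]` and `χ = 0` outside `[-2,2]`. -/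
noncomputable def chi (r : ℝ) : ℝ := Real.smoothTransition (2 - |r|)

/-- The dyadic partition of unity `ρ_j`, `j ≥ -1`:
`ρ_{-1} = χ`, and `ρ_j(r) = χ(r/2^{j+1}) - χ(r/2^j)` for `j ≥ 0`. -/
noncomputable def rho (j : ℤ) (r : ℝ) : ℝ :=
  if j = -1 then chi r else chi (r / (2:ℝ) ^ (j + 1)) - chi (r / (2:ℝ) ^ j)

/-- Euclidean norm of a frequency `n ∈ ℤ^d`. -/
noncomputable def znorm {d : ℕ} (n : Fin d → ℤ) : ℝ :=
  Real.sqrt (∑ i, ((n i : ℝ)) ^ 2)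

/-- The character `e^{i n·x}` on the torus. -/
noncomputable def charFun {d : ℕ} (n : Fin d → ℤ) (x : Fin d → ℝ) : ℂ :=
  Complex.exp (Complex.I * ((∑ i, (n i : ℝ) * x i : ℝ) : ℂ))

/-- The (periodic) function with Fourier coefficients `c`. -/
noncomputable def funOf {d : ℕ} (c : (Fin d → ℤ) → ℂ) (x : Fin d → ℝ) : ℂ :=
  ∑' n, c n * charFun n x

/-- The Littlewood–Paley block `Δ_j f` of the distribution with coefficients `c`. -/
noncomputable def blockFun {d : ℕ} (c : (Fin d → ℤ) → ℂ) (j : ℤ) :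
    (Fin d → ℝ) → ℂ :=
  funOf (fun n => ((rho j (znorm n) : ℝ) : ℂ) * c n)

/-- `L^∞` (sup) norm of a function on the torus. -/
noncomputable def supNorm {d : ℕ} (F : (Fin d → ℝ) → ℂ) : ℝ := ⨆ x, ‖F x‖

/-- The Hölder–Zygmund norm `‖f‖_{C^β} = sup_{j ≥ -1} 2^{βj} ‖Δ_j f‖_{L^∞}`. -/
noncomputable def besovNorm {d : ℕ} (β : ℝ) (c : (Fin d → ℤ) → ℂ) : ℝ :=
  ⨆ j : {j : ℤ // -1 ≤ j}, (2:ℝ) ^ (β * (j.1 : ℝ)) * supNorm (blockFun c j.1)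

/-- Finiteness of the `C^β` norm (membership in `C^β = B^β_{∞,∞}`). -/
def BesovFinite {d : ℕ} (β : ℝ) (c : (Fin d → ℤ) → ℂ) : Prop :=
  BddAbove (Set.range fun j : {j : ℤ // -1 ≤ j} =>
    (2:ℝ) ^ (β * (j.1 : ℝ)) * supNorm (blockFun c j.1))

/-- The heat semigroup `P_t = e^{tΔ}` acting on Fourier coefficients. -/
noncomputable def heat {d : ℕ} (t : ℝ) (c : (Fin d → ℤ) → ℂ) :
    (Fin d → ℤ) → ℂ :=
  fun n => Complex.exp ((-(t * (znorm n) ^ 2) : ℝ) : ℂ) * c n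

/-- The resonant product `f ∘ g = ∑_{|i-j| ≤ 1, i,j ≥ -1} Δ_i f Δ_j g`, on the
Fourier side. -/
noncomputable def resCoeff {d : ℕ} (c₁ c₂ : (Fin d → ℤ) → ℂ) :
    (Fin d → ℤ) → ℂ :=
  fun n => ∑' i : ℤ, ∑' j : ℤ, ∑' m : Fin d → ℤ,
    if -1 ≤ i ∧ -1 ≤ j ∧ |i - j| ≤ 1 then
      ((rho i (znorm m) : ℝ) : ℂ) * c₁ m *
        ((rho j (znorm (n - m)) : ℝ) : ℂ) * c₂ (n - m)
    else 0

section

open MeasureTheory hiding charFun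
open scoped FourierTransform SchwartzMap

lemma contDiff_chi_norm (d : ℕ) :
    ContDiff ℝ (⊤ : ℕ∞) (fun ξ : EuclideanSpace ℝ (Fin d) => ((chi ‖ξ‖ : ℝ) : ℂ)) := by
  refine Complex.ofRealCLM.contDiff.comp (contDiff_iff_contDiffAt.2 fun ξ => ?_)
  by_cases hξ : ξ = 0
  · subst hξ
    refine (contDiffAt_const (c := (1 : ℝ))).congr_of_eventuallyEq ?_
    filter_upwards [Metric.ball_mem_nhds (0 : EuclideanSpace ℝ (Fin d)) one_pos] with ζ hζ
    rw [mem_ball_zero_iff] at hζ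
    refine Real.smoothTransition.one_of_one_le ?_
    rw [abs_norm]
    linarith
  · simp only [abs_norm]
    exact Real.smoothTransition.contDiffAt.comp ξ
      (contDiffAt_const.sub (contDiffAt_norm ℝ hξ))

lemma chi_eq_zero {r : ℝ} (hr : 2 ≤ r) : chi r = 0 :=
  Real.smoothTransition.zero_of_nonpos (by linarith [le_abs_self r])

lemma chi_eq_one {r : ℝ} (h0 : 0 ≤ r) (hr : r ≤ 1) : chi r = 1 :=
  Real.smoothTransition.one_of_one_le (by rw [abs_of_nonneg h0]; linarith)

lemma exists_integrable_fourier_repr_chi (d : ℕ) :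
    ∃ ψ : EuclideanSpace ℝ (Fin d) → ℂ, Integrable ψ ∧
      ∀ ξ : EuclideanSpace ℝ (Fin d), ((chi ‖ξ‖ : ℝ) : ℂ) =
        ∫ v, Complex.exp (Complex.I * ((2 * Real.pi * ∑ i, ξ i * v i : ℝ) : ℂ)) * ψ v := by
  have hc : HasCompactSupport
      (fun ξ : EuclideanSpace ℝ (Fin d) => ((chi ‖ξ‖ : ℝ) : ℂ)) := by
    refine HasCompactSupport.intro (isCompact_closedBall 0 2) fun ξ hξ => ?_
    rw [mem_closedBall_zero_iff, not_le] at hξ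
    rw [chi_eq_zero hξ.le, Complex.ofReal_zero]
  set φ : 𝓢(EuclideanSpace ℝ (Fin d), ℂ) := hc.toSchwartzMap (contDiff_chi_norm d) with hφ
  set ψ : 𝓢(EuclideanSpace ℝ (Fin d), ℂ) := 𝓕 φ with hψ
  refine ⟨ψ, ψ.integrable, fun ξ => ?_⟩
  have h : (𝓕⁻ ψ) ξ = φ ξ := by rw [hψ, FourierTransform.fourierInv_fourier_eq]
  rw [SchwartzMap.fourierInv_coe, Real.fourierInv_eq'] at h
  calc ((chi ‖ξ‖ : ℝ) : ℂ) = φ ξ := rfl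
    _ = _ := h.symm
    _ = _ := by
      refine integral_congr_ae (Filter.Eventually.of_forall fun v => ?_)
      simp only [smul_eq_mul, PiLp.inner_apply, RCLike.inner_apply, conj_trivial]
      congr 2
      push_cast
      ring

lemma charFun_add_right {d : ℕ} (n : Fin d → ℤ) (x y : Fin d → ℝ) :
    charFun n (x + y) = charFun n x * charFun n y := by
  simp only [charFun, ← Complex.exp_add, Pi.add_apply, mul_add, Finset.sum_add_distrib,
    Complex.ofReal_add]

lemma charFun_add_left {d : ℕ} (n m : Fin d → ℤ) (x : Fin d → ℝ) :
    charFun (n + m) x = charFun n x * charFun m x := by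
  simp only [charFun, ← Complex.exp_add, Pi.add_apply, Int.cast_add, add_mul,
    Finset.sum_add_distrib, Complex.ofReal_add, mul_add]

lemma norm_charFun {d : ℕ} (n : Fin d → ℤ) (x : Fin d → ℝ) : ‖charFun n x‖ = 1 := by
  rw [charFun, mul_comm, Complex.norm_exp_ofReal_mul_I]

lemma funOf_eq_sum {d : ℕ} {c : (Fin d → ℤ) → ℂ} {S : Finset (Fin d → ℤ)}
    (hS : ∀ n ∉ S, c n = 0) (x : Fin d → ℝ) : funOf c x = ∑ n ∈ S, c n * charFun n x :=
  tsum_eq_sum fun n hn => by rw [hS n hn, zero_mul]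

/-- Dilated and translated copies of the cutoff are Fourier multipliers on trigonometric
polynomials, uniformly bounded in the sup norm. -/
lemma exists_chi_multiplier_bound (d : ℕ) :
    ∃ K > (0 : ℝ), ∀ (R : ℝ) (n₀ : Fin d → ℤ) (c : (Fin d → ℤ) → ℂ) (M : ℝ), 0 < R →
      c.support.Finite → (∀ x, ‖funOf c x‖ ≤ M) →
      ∀ x, ‖funOf (fun n => ((chi (znorm (n - n₀) / R) : ℝ) : ℂ) * c n) x‖ ≤ K * M := by
  obtain ⟨ψ, hψ, hrep⟩ := exists_integrable_fourier_repr_chi d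
  refine ⟨(∫ v, ‖ψ v‖) + 1, by positivity, fun R n₀ c M hR hc hM x => ?_⟩
  have hM0 : 0 ≤ M := (norm_nonneg _).trans (hM 0)
  have hS : ∀ n ∉ hc.toFinset, c n = 0 := fun n hn => by simpa using hn
  set y : EuclideanSpace ℝ (Fin d) → Fin d → ℝ := fun v i => 2 * Real.pi / R * v i with hy
  have hy_cont : Continuous y := by rw [hy]; fun_prop
  have hchar_cont : ∀ n : Fin d → ℤ, Continuous (charFun n) := fun n => by
    unfold charFun; fun_prop
  have hchi : ∀ n : Fin d → ℤ, ((chi (znorm (n - n₀) / R) : ℝ) : ℂ) =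
      ∫ v, charFun (n - n₀) (y v) * ψ v := fun n => by
    have hnorm : ‖(WithLp.toLp 2 fun i => ((n i - n₀ i : ℤ) : ℝ) / R :
        EuclideanSpace ℝ (Fin d))‖ = znorm (n - n₀) / R := by
      rw [EuclideanSpace.norm_eq]
      simp only [Real.norm_eq_abs, sq_abs, div_pow, ← Finset.sum_div]
      rw [Real.sqrt_div' _ (sq_nonneg R), Real.sqrt_sq hR.le]
      rfl
    rw [← hnorm, hrep]
    refine integral_congr_ae (Filter.Eventually.of_forall fun v => ?_)
    simp only [charFun, hy, Finset.mul_sum, Pi.sub_apply]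
    congr 4
    refine Finset.sum_congr rfl fun i _ => ?_
    ring
  have hint : ∀ n : Fin d → ℤ, Integrable fun v => charFun (n - n₀) (y v) * ψ v := fun n =>
    hψ.bdd_mul ((hchar_cont _).comp hy_cont).aestronglyMeasurable
      (Filter.Eventually.of_forall fun v => (norm_charFun _ _).le)
  have hkey : funOf (fun n => ((chi (znorm (n - n₀) / R) : ℝ) : ℂ) * c n) x =
      ∫ v, charFun (-n₀) (y v) * funOf c (x + y v) * ψ v := by
    rw [funOf_eq_sum (S := hc.toFinset) (fun n hn => by rw [hS n hn, mul_zero])]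
    simp_rw [hchi, funOf_eq_sum hS, Finset.mul_sum, Finset.sum_mul]
    rw [integral_finsetSum]
    · refine Finset.sum_congr rfl fun n _ => ?_
      rw [mul_assoc, ← integral_mul_const]
      refine integral_congr_ae (Filter.Eventually.of_forall fun v => ?_)
      simp only [charFun_add_right, sub_eq_add_neg, charFun_add_left]
      ring
    · intro n _
      refine ((hint n).const_mul (c n * charFun n x)).congr
        (Filter.Eventually.of_forall fun v => ?_)
      simp only [charFun_add_right, sub_eq_add_neg, charFun_add_left]
      ring
  rw [hkey]
  calc _ ≤ ∫ v, ‖ψ v‖ * M := by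
        refine norm_integral_le_of_norm_le (hψ.norm.mul_const M)
          (Filter.Eventually.of_forall fun v => ?_)
        rw [norm_mul, norm_mul, norm_charFun, one_mul, mul_comm]
        exact mul_le_mul_of_nonneg_left (hM _) (norm_nonneg _)
    _ = (∫ v, ‖ψ v‖) * M := integral_mul_const _ _
    _ ≤ _ := by nlinarith

end

lemma znorm_eq_norm {d : ℕ} (n : Fin d → ℤ) :
    znorm n = ‖(WithLp.toLp 2 fun i => (n i : ℝ) : EuclideanSpace ℝ (Fin d))‖ := by
  simp [EuclideanSpace.norm_eq, znorm]

lemma znorm_nonneg {d : ℕ} (n : Fin d → ℤ) : 0 ≤ znorm n := Real.sqrt_nonneg _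

lemma znorm_add_le {d : ℕ} (n m : Fin d → ℤ) : znorm (n + m) ≤ znorm n + znorm m := by
  simp only [znorm_eq_norm]
  refine le_of_eq_of_le (congrArg _ ?_) (norm_add_le _ _)
  ext i
  simp

lemma abs_apply_le_znorm {d : ℕ} (n : Fin d → ℤ) (i : Fin d) : |(n i : ℝ)| ≤ znorm n :=
  Real.abs_le_sqrt (Finset.single_le_sum (f := fun i => ((n i : ℝ)) ^ 2)
    (fun _ _ => sq_nonneg _) (Finset.mem_univ i))

lemma finite_setOf_znorm_lt (d : ℕ) (R : ℝ) : {n : Fin d → ℤ | znorm n < R}.Finite := by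
  refine (Set.finite_Icc (fun _ => -⌈R⌉) (fun _ => ⌈R⌉)).subset fun n hn => ?_
  have h : ∀ i, |n i| ≤ ⌈R⌉ := fun i => by
    have : |(n i : ℝ)| ≤ (⌈R⌉ : ℝ) :=
      (abs_apply_le_znorm n i).trans ((le_of_lt hn).trans (Int.le_ceil R))
    exact_mod_cast this
  exact ⟨fun i => (abs_le.1 (h i)).1, fun i => (abs_le.1 (h i)).2⟩

lemma one_le_znorm {d : ℕ} {n : Fin d → ℤ} (hn : n ≠ 0) : 1 ≤ znorm n := by
  obtain ⟨i, hi⟩ := Function.ne_iff.1 hn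
  refine le_trans ?_ (abs_apply_le_znorm n i)
  exact_mod_cast Int.one_le_abs hi

lemma rho_eq_zero_of_le {j : ℤ} {r : ℝ} (hr : (2 : ℝ) ^ (j + 2) ≤ r) : rho j r = 0 := by
  have hj : (2 : ℝ) ^ (j + 2) = 2 * 2 ^ (j + 1) := by
    rw [show j + 2 = 1 + (j + 1) by ring, zpow_add₀ two_ne_zero, zpow_one]
  have hj' : (2 : ℝ) ^ (j + 1) = 2 * 2 ^ j := by
    rw [add_comm j, zpow_add₀ two_ne_zero, zpow_one]
  have hpos : (0 : ℝ) < 2 ^ j := by positivity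
  rw [rho]
  split_ifs with h
  · subst h
    exact chi_eq_zero (by norm_num at hr; exact hr)
  · rw [chi_eq_zero, chi_eq_zero, sub_zero]
    · rw [le_div_iff₀ hpos]; linarith
    · rw [le_div_iff₀ (by positivity)]; linarith

lemma rho_eq_zero_of_le_zpow {j : ℤ} (hj : 0 ≤ j) {r : ℝ} (h0 : 0 ≤ r)
    (hr : r ≤ (2 : ℝ) ^ j) : rho j r = 0 := by
  have hpos : (0 : ℝ) < 2 ^ j := by positivity
  have hj' : (2 : ℝ) ^ (j + 1) = 2 * 2 ^ j := by
    rw [add_comm j, zpow_add₀ two_ne_zero, zpow_one]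
  rw [rho, if_neg (by omega), chi_eq_one, chi_eq_one, sub_self]
  · positivity
  · rw [div_le_one hpos]; exact hr
  · positivity
  · rw [div_le_one (by positivity)]; linarith

lemma finite_support_rho_mul {d : ℕ} (c : (Fin d → ℤ) → ℂ) (j : ℤ) :
    (fun n => ((rho j (znorm n) : ℝ) : ℂ) * c n).support.Finite := by
  refine (finite_setOf_znorm_lt d (2 ^ (j + 2))).subset fun n hn => ?_
  by_contra h
  rw [Set.mem_ofPred_eq, not_lt] at h
  exact hn (by simp only [rho_eq_zero_of_le h, Complex.ofReal_zero, zero_mul])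

lemma summable_mul_charFun {d : ℕ} {c : (Fin d → ℤ) → ℂ} (hc : c.support.Finite)
    (x : Fin d → ℝ) : Summable fun n => c n * charFun n x :=
  summable_of_hasFiniteSupport (hc.subset fun n hn h => hn (by simp only [h, zero_mul]))

lemma norm_funOf_le {d : ℕ} {c : (Fin d → ℤ) → ℂ} (hc : c.support.Finite) (x : Fin d → ℝ) :
    ‖funOf c x‖ ≤ ∑ n ∈ hc.toFinset, ‖c n‖ := by
  rw [funOf_eq_sum (S := hc.toFinset) (fun n hn => by simpa using hn)]
  refine (norm_sum_le _ _).trans (le_of_eq (Finset.sum_congr rfl fun n _ => ?_))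
  rw [norm_mul, norm_charFun, mul_one]

lemma norm_blockFun_le_supNorm {d : ℕ} (c : (Fin d → ℤ) → ℂ) (j : ℤ) (x : Fin d → ℝ) :
    ‖blockFun c j x‖ ≤ supNorm (blockFun c j) :=
  le_ciSup (f := fun x => ‖blockFun c j x‖)
    ⟨_, Set.forall_mem_range.2 (norm_funOf_le (finite_support_rho_mul c j))⟩ x

lemma norm_blockFun_le_besovNorm {d : ℕ} {β : ℝ} {c : (Fin d → ℤ) → ℂ} (hc : BesovFinite β c)
    {j : ℤ} (hj : -1 ≤ j) (x : Fin d → ℝ) :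
    ‖blockFun c j x‖ ≤ (2 : ℝ) ^ (-(β * j)) * besovNorm β c := by
  have h : (2 : ℝ) ^ (β * j) * supNorm (blockFun c j) ≤ besovNorm β c := le_ciSup hc ⟨j, hj⟩
  rw [Real.rpow_neg two_pos.le, inv_mul_eq_div, le_div_iff₀' (by positivity)]
  exact (mul_le_mul_of_nonneg_left (norm_blockFun_le_supNorm c j x) (by positivity)).trans h

lemma besovNorm_nonneg {d : ℕ} (β : ℝ) (c : (Fin d → ℤ) → ℂ) : 0 ≤ besovNorm β c :=
  Real.iSup_nonneg fun _ => mul_nonneg (by positivity) (Real.iSup_nonneg fun _ => norm_nonneg _)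

/-- Convolution of finitely supported coefficients corresponds to the pointwise product. -/
lemma funOf_convolution {d : ℕ} {a b : (Fin d → ℤ) → ℂ} (ha : a.support.Finite)
    (hb : b.support.Finite) (x : Fin d → ℝ) :
    HasSum (fun n => (∑' m, a m * b (n - m)) * charFun n x) (funOf a x * funOf b x) := by
  have hS : ∀ n ∉ ha.toFinset, a n = 0 := fun n hn => by simpa using hn
  rw [funOf_eq_sum hS, Finset.sum_mul]
  have h : ∀ m ∈ ha.toFinset, HasSum
      (fun n => a m * charFun m x * (b (n - m) * charFun (n - m) x))
      (a m * charFun m x * funOf b x) := fun m _ =>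
    ((Equiv.subRight m).hasSum_iff.2 (summable_mul_charFun hb x).hasSum).mul_left _
  refine (hasSum_sum h).congr_fun fun n => ?_
  rw [tsum_eq_sum (s := ha.toFinset) fun m hm => by rw [hS m hm, zero_mul], Finset.sum_mul]
  refine Finset.sum_congr rfl fun m _ => ?_
  rw [show charFun n x = charFun m x * charFun (n - m) x by
    rw [← charFun_add_left, add_sub_cancel]]
  ring

/-- The coefficients of `Δ_i f · ∑_{|j - i| ≤ 1} Δ_j g`. -/
noncomputable def resTerm {d : ℕ} (c₁ c₂ : (Fin d → ℤ) → ℂ) (i : ℤ) : (Fin d → ℤ) → ℂ :=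
  fun n => ∑' j : ℤ, ∑' m : Fin d → ℤ,
    if -1 ≤ i ∧ -1 ≤ j ∧ |i - j| ≤ 1 then
      ((rho i (znorm m) : ℝ) : ℂ) * c₁ m *
        ((rho j (znorm (n - m)) : ℝ) : ℂ) * c₂ (n - m)
    else 0

lemma resCoeff_eq_tsum_resTerm {d : ℕ} (c₁ c₂ : (Fin d → ℤ) → ℂ) (n : Fin d → ℤ) :
    resCoeff c₁ c₂ n = ∑' i, resTerm c₁ c₂ i n := rfl

lemma resTerm_of_lt {d : ℕ} (c₁ c₂ : (Fin d → ℤ) → ℂ) {i : ℤ} (hi : i < -1)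
    (n : Fin d → ℤ) : resTerm c₁ c₂ i n = 0 := by
  simp [resTerm, not_le.2 hi]

lemma resTerm_eq_zero_of_le {d : ℕ} (c₁ c₂ : (Fin d → ℤ) → ℂ) {i : ℤ} {n : Fin d → ℤ}
    (hn : (2 : ℝ) ^ (i + 4) ≤ znorm n) : resTerm c₁ c₂ i n = 0 := by
  rw [resTerm]
  refine (tsum_congr fun j => (tsum_congr fun m => ?_).trans tsum_zero).trans tsum_zero
  split_ifs with h
  · obtain ⟨-, -, hij⟩ := h
    rcases le_or_gt ((2 : ℝ) ^ (i + 2)) (znorm m) with hm | hm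
    · simp [rho_eq_zero_of_le hm]
    · have h1 : znorm n ≤ znorm m + znorm (n - m) := by
        simpa using znorm_add_le m (n - m)
      have h2 : (2 : ℝ) ^ (i + 4) = 4 * 2 ^ (i + 2) := by
        rw [show i + 4 = 2 + (i + 2) by ring, zpow_add₀ two_ne_zero]; norm_num
      have h3 : (2 : ℝ) ^ (i + 3) = 2 * 2 ^ (i + 2) := by
        rw [show i + 3 = 1 + (i + 2) by ring, zpow_add₀ two_ne_zero]; norm_num
      have h4 : (2 : ℝ) ^ (j + 2) ≤ 2 ^ (i + 3) :=
        zpow_le_zpow_right₀ one_le_two (by have := (abs_le.1 hij).1; omega)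
      have h5 : (0 : ℝ) < 2 ^ (i + 2) := by positivity
      rw [rho_eq_zero_of_le (by linarith : (2 : ℝ) ^ (j + 2) ≤ znorm (n - m))]
      simp
  · rfl

lemma finite_support_resTerm {d : ℕ} (c₁ c₂ : (Fin d → ℤ) → ℂ) (i : ℤ) :
    (resTerm c₁ c₂ i).support.Finite := by
  refine (finite_setOf_znorm_lt d (2 ^ (i + 4))).subset fun n hn => ?_
  by_contra h
  exact hn (resTerm_eq_zero_of_le c₁ c₂ (not_lt.1 h))

lemma funOf_resTerm {d : ℕ} (c₁ c₂ : (Fin d → ℤ) → ℂ) {i : ℤ} (hi : -1 ≤ i)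
    (x : Fin d → ℝ) :
    funOf (resTerm c₁ c₂ i) x =
      ∑ j ∈ Finset.Icc (max (-1) (i - 1)) (i + 1), blockFun c₁ i x * blockFun c₂ j x := by
  refine HasSum.tsum_eq ((hasSum_sum fun j _ => funOf_convolution (finite_support_rho_mul c₁ i)
    (finite_support_rho_mul c₂ j) x).congr_fun fun n => ?_)
  rw [← Finset.sum_mul, resTerm,
    tsum_eq_sum (s := Finset.Icc (max (-1) (i - 1)) (i + 1)) fun j hj => ?_]
  · congr 1
    refine Finset.sum_congr rfl fun j hj => tsum_congr fun m => ?_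
    rw [Finset.mem_Icc, max_le_iff] at hj
    rw [if_pos ⟨hi, hj.1.1, abs_le.2 ⟨by omega, by omega⟩⟩]
    ring
  · rw [Finset.mem_Icc, max_le_iff] at hj
    have hcond : ¬ (-1 ≤ i ∧ -1 ≤ j ∧ |i - j| ≤ 1) := fun ⟨_, h1, h2⟩ => by
      rw [abs_le] at h2
      exact hj ⟨⟨h1, by omega⟩, by omega⟩
    simp only [if_neg hcond, tsum_zero]

lemma norm_funOf_resTerm_le {d : ℕ} {α β : ℝ} {c₁ c₂ : (Fin d → ℤ) → ℂ}
    (h₁ : BesovFinite α c₁) (h₂ : BesovFinite β c₂) {i : ℤ} (hi : -1 ≤ i) (x : Fin d → ℝ) :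
    ‖funOf (resTerm c₁ c₂ i) x‖ ≤
      3 * 2 ^ |β| * (besovNorm α c₁ * besovNorm β c₂) * (2 : ℝ) ^ (-((α + β) * i)) := by
  have hA := besovNorm_nonneg α c₁
  have hB := besovNorm_nonneg β c₂
  rw [funOf_resTerm c₁ c₂ hi]
  have hterm : ∀ j ∈ Finset.Icc (max (-1) (i - 1)) (i + 1),
      ‖blockFun c₁ i x * blockFun c₂ j x‖ ≤
        2 ^ |β| * (besovNorm α c₁ * besovNorm β c₂) * (2 : ℝ) ^ (-((α + β) * i)) := by
    intro j hj
    rw [Finset.mem_Icc, max_le_iff] at hj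
    have hexp : (2 : ℝ) ^ (-(β * j)) ≤ 2 ^ |β| * 2 ^ (-(β * i)) := by
      rw [← Real.rpow_add two_pos]
      refine Real.rpow_le_rpow_of_exponent_le one_le_two ?_
      have hij : |(i : ℝ) - j| ≤ 1 := by
        have : |i - j| ≤ 1 := abs_le.2 ⟨by omega, by omega⟩
        exact_mod_cast this
      have := (le_abs_self (β * ((i : ℝ) - j))).trans
        ((abs_mul _ _).trans_le (mul_le_of_le_one_right (abs_nonneg β) hij))
      linarith
    have hsplit : (2 : ℝ) ^ (-((α + β) * i)) = 2 ^ (-(α * i)) * 2 ^ (-(β * i)) := by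
      rw [← Real.rpow_add two_pos]; ring_nf
    rw [norm_mul]
    calc _ ≤ ((2 : ℝ) ^ (-(α * i)) * besovNorm α c₁) *
          ((2 ^ |β| * 2 ^ (-(β * i))) * besovNorm β c₂) := by
          refine mul_le_mul (norm_blockFun_le_besovNorm h₁ hi x)
            ((norm_blockFun_le_besovNorm h₂ hj.1.1 x).trans ?_) (norm_nonneg _) (by positivity)
          exact mul_le_mul_of_nonneg_right hexp hB
      _ = _ := by rw [hsplit]; ring
  refine (norm_sum_le_of_le _ hterm).trans ?_
  rw [Finset.sum_const, nsmul_eq_mul, mul_assoc 3, mul_assoc 3]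
  refine mul_le_mul_of_nonneg_right ?_ (by positivity)
  have : (Finset.Icc (max (-1) (i - 1)) (i + 1)).card ≤ 3 := by
    rw [Int.card_Icc]; omega
  exact_mod_cast this

/-- Littlewood–Paley blocks and single Fourier coefficients of trigonometric polynomials are
bounded by the sup norm, uniformly in the block or the frequency. -/
lemma exists_blockFun_bound (d : ℕ) :
    ∃ K > (0 : ℝ), ∀ (c : (Fin d → ℤ) → ℂ) (M : ℝ), c.support.Finite →
      (∀ x, ‖funOf c x‖ ≤ M) →
      (∀ k x, ‖blockFun c k x‖ ≤ K * M) ∧ ∀ n, ‖c n‖ ≤ K * M := by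
  obtain ⟨K, hK, h⟩ := exists_chi_multiplier_bound d
  refine ⟨2 * K, by positivity, fun c M hc hM => ?_⟩
  have hM0 : 0 ≤ K * M := mul_nonneg hK.le ((norm_nonneg _).trans (hM 0))
  have hS : ∀ n ∉ hc.toFinset, c n = 0 := fun n hn => by simpa using hn
  refine ⟨fun k x => ?_, fun n => ?_⟩
  · by_cases hk : k = -1
    · have := h 1 0 c M one_pos hc hM x
      simp only [sub_zero, div_one] at this
      simp only [blockFun, rho, if_pos hk]
      linarith
    · have h1 := h (2 ^ (k + 1)) 0 c M (by positivity) hc hM x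
      have h2 := h (2 ^ k) 0 c M (by positivity) hc hM x
      simp only [sub_zero] at h1 h2
      have hsub : blockFun c k x =
          funOf (fun n => ((chi (znorm n / 2 ^ (k + 1)) : ℝ) : ℂ) * c n) x -
            funOf (fun n => ((chi (znorm n / 2 ^ k) : ℝ) : ℂ) * c n) x := by
        simp only [blockFun, rho, if_neg hk]
        iterate 3 rw [funOf_eq_sum (S := hc.toFinset) fun n hn => by rw [hS n hn, mul_zero]]
        rw [← Finset.sum_sub_distrib]
        refine Finset.sum_congr rfl fun n _ => ?_
        push_cast
        ring
      rw [hsub]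
      linarith [norm_sub_le
        (funOf (fun n => ((chi (znorm n / 2 ^ (k + 1)) : ℝ) : ℂ) * c n) x)
        (funOf (fun n => ((chi (znorm n / 2 ^ k) : ℝ) : ℂ) * c n) x)]
  · have h1 := h (1 / 2) n c M (by norm_num) hc hM 0
    rw [funOf_eq_sum (S := {n}) fun m hm => ?_, Finset.sum_singleton, norm_mul, norm_mul,
      norm_charFun, sub_self, chi_eq_one (by rw [znorm_eq_norm]; positivity)] at h1
    · simp only [Complex.ofReal_one, norm_one, one_mul, mul_one] at h1
      linarith
    · simp [znorm]
    · have := one_le_znorm (sub_ne_zero.2 (Finset.notMem_singleton.1 hm))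
      rw [chi_eq_zero (by linarith), Complex.ofReal_zero, zero_mul]

lemma blockFun_eq_zero {d : ℕ} {c : (Fin d → ℤ) → ℂ} {k : ℤ}
    (h : ∀ n, ((rho k (znorm n) : ℝ) : ℂ) * c n = 0) (x : Fin d → ℝ) : blockFun c k x = 0 :=
  (tsum_congr fun n => by simp only [h n, zero_mul]).trans tsum_zero

lemma blockFun_resTerm_eq_zero {d : ℕ} (c₁ c₂ : (Fin d → ℤ) → ℂ) {i k : ℤ} (hk : -1 ≤ k)
    (hi : i < k - 3) (x : Fin d → ℝ) : blockFun (resTerm c₁ c₂ i) k x = 0 := by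
  refine blockFun_eq_zero (fun n => ?_) x
  by_cases hi' : i < -1
  · rw [resTerm_of_lt c₁ c₂ hi', mul_zero]
  rcases le_or_gt ((2 : ℝ) ^ (i + 4)) (znorm n) with hn | hn
  · rw [resTerm_eq_zero_of_le c₁ c₂ hn, mul_zero]
  · rw [rho_eq_zero_of_le_zpow (by omega) (znorm_nonneg n)
      (hn.le.trans (zpow_le_zpow_right₀ one_le_two (by omega))), Complex.ofReal_zero,
      zero_mul]

lemma hasSum_int_ge_rpow {s : ℝ} (hs : 0 < s) (k : ℤ) :
    HasSum (fun i : ℤ => if k ≤ i then (2 : ℝ) ^ (-(s * i)) else 0)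
      (2 ^ (-(s * k)) * (1 - 2 ^ (-s))⁻¹) := by
  have hinj : Function.Injective fun l : ℕ => k + (l : ℤ) := fun a b hab => by
    simpa using hab
  rw [← hinj.hasSum_iff]
  · refine ((hasSum_geometric_of_lt_one (by positivity)
      (Real.rpow_lt_one_of_one_lt_of_neg one_lt_two (neg_neg_of_pos hs))).mul_left
      ((2 : ℝ) ^ (-(s * k)))).congr_fun fun l => ?_
    simp only [Function.comp_apply, le_add_iff_nonneg_right, Nat.cast_nonneg, if_true]
    rw [← Real.rpow_natCast, ← Real.rpow_mul two_pos.le, ← Real.rpow_add two_pos]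
    push_cast
    ring_nf
  · intro i hi
    rw [if_neg]
    intro hki
    exact hi ⟨(i - k).toNat, by simp only []; omega⟩

lemma blockFun_resCoeff {d : ℕ} {c₁ c₂ : (Fin d → ℤ) → ℂ}
    (hsum : ∀ n, Summable fun i => resTerm c₁ c₂ i n) (k : ℤ) (x : Fin d → ℝ) :
    blockFun (resCoeff c₁ c₂) k x = ∑' i, blockFun (resTerm c₁ c₂ i) k x := by
  have hS : ∀ (c : (Fin d → ℤ) → ℂ), ∀ n ∉ (finite_setOf_znorm_lt d (2 ^ (k + 2))).toFinset,
      ((rho k (znorm n) : ℝ) : ℂ) * c n = 0 := fun c n hn => by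
    rw [Set.Finite.mem_toFinset, Set.mem_ofPred_eq, not_lt] at hn
    rw [rho_eq_zero_of_le hn, Complex.ofReal_zero, zero_mul]
  simp only [blockFun]
  simp_rw [fun c : (Fin d → ℤ) → ℂ => funOf_eq_sum (hS c) x]
  rw [Summable.tsum_finsetSum fun n _ => ((hsum n).mul_left _).mul_right _]
  refine Finset.sum_congr rfl fun n _ => ?_
  rw [tsum_mul_right, tsum_mul_left, resCoeff_eq_tsum_resTerm]

/-- Resonant product bound: for `α + β > 0` there is `C` such that
for all `f ∈ C^α(𝕋^d)` and `g ∈ C^β(𝕋^d)`,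
`‖f ∘ g‖_{C^{α+β}} ≤ C ‖f‖_{C^α} ‖g‖_{C^β}`. -/
theorem stmt_17 {d : ℕ} (α β : ℝ) (hαβ : 0 < α + β) :
    ∃ C > (0:ℝ), ∀ c₁ c₂ : (Fin d → ℤ) → ℂ,
      BesovFinite α c₁ → BesovFinite β c₂ →
      besovNorm (α + β) (resCoeff c₁ c₂) ≤ C * besovNorm α c₁ * besovNorm β c₂ := by
  obtain ⟨K, hK, hbound⟩ := exists_blockFun_bound d
  have hlt : (2 : ℝ) ^ (-(α + β)) < 1 :=
    Real.rpow_lt_one_of_one_lt_of_neg one_lt_two (neg_neg_of_pos hαβ)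
  have hinv : 0 < (1 - (2 : ℝ) ^ (-(α + β)))⁻¹ := inv_pos.2 (sub_pos.2 hlt)
  refine ⟨K * (3 * 2 ^ |β|) * (2 ^ ((α + β) * 3) * (1 - 2 ^ (-(α + β)))⁻¹), by positivity,
    fun c₁ c₂ h₁ h₂ => ?_⟩
  have hA := besovNorm_nonneg α c₁
  have hB := besovNorm_nonneg β c₂
  set D : ℝ := K * (3 * 2 ^ |β|) * (besovNorm α c₁ * besovNorm β c₂) with hD
  have hD0 : 0 ≤ D := by positivity
  have hterm : ∀ i : ℤ, -1 ≤ i →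
      (∀ k x, ‖blockFun (resTerm c₁ c₂ i) k x‖ ≤ D * 2 ^ (-((α + β) * i))) ∧
        ∀ n, ‖resTerm c₁ c₂ i n‖ ≤ D * 2 ^ (-((α + β) * i)) := fun i hi => by
    have := hbound _ _ (finite_support_resTerm c₁ c₂ i) (norm_funOf_resTerm_le h₁ h₂ hi)
    simpa only [hD, mul_assoc] using this
  have hsum : ∀ n, Summable fun i => resTerm c₁ c₂ i n := fun n => by
    refine Summable.of_norm_bounded
      ((hasSum_int_ge_rpow hαβ (-1)).mul_left D).summable fun i => ?_
    split_ifs with hi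
    · exact (hterm i hi).2 n
    · rw [resTerm_of_lt c₁ c₂ (not_le.1 hi), norm_zero, mul_zero]
  have : Nonempty {j : ℤ // -1 ≤ j} := ⟨⟨-1, le_rfl⟩⟩
  refine ciSup_le fun ⟨k, hk⟩ => ?_
  have hsup : supNorm (blockFun (resCoeff c₁ c₂) k) ≤
      D * (2 ^ (-((α + β) * (k - 3 : ℤ))) * (1 - 2 ^ (-(α + β)))⁻¹) := by
    refine ciSup_le fun x => ?_
    rw [blockFun_resCoeff hsum]
    refine tsum_of_norm_bounded ((hasSum_int_ge_rpow hαβ (k - 3)).mul_left D) fun i => ?_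
    split_ifs with hi
    · rcases le_or_gt (-1) i with hi' | hi'
      · exact (hterm i hi').1 k x
      · have hzero : blockFun (resTerm c₁ c₂ i) k x = 0 :=
          blockFun_eq_zero (fun n => by rw [resTerm_of_lt c₁ c₂ hi', mul_zero]) x
        rw [hzero, norm_zero]
        positivity
    · rw [blockFun_resTerm_eq_zero c₁ c₂ hk (not_le.1 hi), norm_zero, mul_zero]
  have hpow : (2 : ℝ) ^ ((α + β) * k) * 2 ^ (-((α + β) * (k - 3 : ℤ))) = 2 ^ ((α + β) * 3) := by
    rw [← Real.rpow_add two_pos]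
    push_cast
    ring_nf
  calc (2 : ℝ) ^ ((α + β) * k) * supNorm (blockFun (resCoeff c₁ c₂) k)
      ≤ 2 ^ ((α + β) * k) *
        (D * (2 ^ (-((α + β) * (k - 3 : ℤ))) * (1 - 2 ^ (-(α + β)))⁻¹)) :=
        mul_le_mul_of_nonneg_left hsup (by positivity)
    _ = D * ((2 ^ ((α + β) * k) * 2 ^ (-((α + β) * (k - 3 : ℤ)))) *
        (1 - 2 ^ (-(α + β)))⁻¹) := by ring
    _ = _ := by rw [hpow, hD]; ring
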